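/- Let ⋆ be a bilinear product on ℝ^{2n+1} with two-sided unit e₁ such that (i) u ⋆ u = −e₁ for every unit vector u ∈ e₁^⊥, and (ii) u ⋆ v − v ⋆ u = 2 e₁ for all u, v ∈ e₁^⊥ with ω(u, v) = 1. Then ⋆ coincides with the Vidinli multiplication: a ⋆ b = (a·e₁) b + (b·e₁) a − (a·b) e₁ + ω(a,b) e₁ for all a, b ∈ ℝ^{2n+1}. In particular, (ℝ^{2n+1}, ⋆) is isomorphic to the Vidinli algebra V_{2n+1}, and its commutator bracket [a,b] := a ⋆ b − b ⋆ a = 2ω(a,b)e₁ gives the (2n+1)-dimensional Heisenberg Lie algebra structure with center ℝe₁. -/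

import Mathlib

noncomputable section

/-- Standard dot product on `ℝ^m`. -/
def dot {m : ℕ} (a b : Fin m → ℝ) : ℝ := ∑ i, a i * b i

/-- The distinguished unit vector `e₁` of the Vidinli algebra (index `0`). -/
def e1 (n : ℕ) : Fin (2*n+1) → ℝ := fun i => if i.val = 0 then 1 else 0

/-- The standard symplectic form `ω` on `ℝ^{2n+1}` (vanishing on `e₁`):
`ω(a,b) = Σ_{k=1}^n (a_{2k} b_{2k+1} − a_{2k+1} b_{2k})` in the paper's 1-based indexing. -/
def omg (n : ℕ) (a b : Fin (2*n+1) → ℝ) : ℝ :=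
  ∑ k : Fin n,
    (a ⟨2*k.val+1, by have := k.isLt; omega⟩ * b ⟨2*k.val+2, by have := k.isLt; omega⟩
   - a ⟨2*k.val+2, by have := k.isLt; omega⟩ * b ⟨2*k.val+1, by have := k.isLt; omega⟩)

/-- The Vidinli multiplication on `ℝ^{2n+1}`. -/
def vprod (n : ℕ) (a b : Fin (2*n+1) → ℝ) : Fin (2*n+1) → ℝ :=
  dot a (e1 n) • b + dot b (e1 n) • a - dot a b • e1 n + omg n a b • e1 n

lemma dot_comm {m : ℕ} (a b : Fin m → ℝ) : dot a b = dot b a := by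
  simp [dot, mul_comm]

lemma dot_add_left {m : ℕ} (a b c : Fin m → ℝ) : dot (a + b) c = dot a c + dot b c := by
  simp [dot, add_mul, Finset.sum_add_distrib]

lemma dot_smul_left {m : ℕ} (r : ℝ) (a b : Fin m → ℝ) : dot (r • a) b = r * dot a b := by
  simp [dot, Finset.mul_sum, mul_assoc]

lemma dot_add_right {m : ℕ} (a b c : Fin m → ℝ) : dot a (b + c) = dot a b + dot a c := by
  simp [dot, mul_add, Finset.sum_add_distrib]

lemma dot_smul_right {m : ℕ} (r : ℝ) (a b : Fin m → ℝ) : dot a (r • b) = r * dot a b := by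
  rw [dot_comm, dot_smul_left, dot_comm]

lemma dot_self_nonneg {m : ℕ} (a : Fin m → ℝ) : 0 ≤ dot a a :=
  Finset.sum_nonneg fun i _ => mul_self_nonneg (a i)

lemma eq_zero_of_dot_self_eq_zero {m : ℕ} {a : Fin m → ℝ} (h : dot a a = 0) : a = 0 := by
  funext i
  have := (Finset.sum_eq_zero_iff_of_nonneg fun i _ => mul_self_nonneg (a i)).1 h i
    (Finset.mem_univ i)
  simpa using this

lemma dot_e1 (n : ℕ) (a : Fin (2*n+1) → ℝ) : dot a (e1 n) = a 0 := by
  rw [dot, Finset.sum_eq_single 0]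
  · simp [e1]
  · intro i _ hi
    have : i.val ≠ 0 := fun h => hi (Fin.ext h)
    simp [e1, this]
  · simp

lemma dot_e1_e1 (n : ℕ) : dot (e1 n) (e1 n) = 1 := by
  simp [dot_e1, e1]

lemma omg_add_left (n : ℕ) (a b c : Fin (2*n+1) → ℝ) :
    omg n (a + b) c = omg n a c + omg n b c := by
  simp only [omg, ← Finset.sum_add_distrib, Pi.add_apply]
  exact Finset.sum_congr rfl fun k _ => by ring

lemma omg_smul_left (n : ℕ) (r : ℝ) (a b : Fin (2*n+1) → ℝ) :
    omg n (r • a) b = r * omg n a b := by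
  simp only [omg, Finset.mul_sum, Pi.smul_apply, smul_eq_mul]
  exact Finset.sum_congr rfl fun k _ => by ring

lemma omg_swap (n : ℕ) (a b : Fin (2*n+1) → ℝ) : omg n b a = -omg n a b := by
  simp only [omg, ← Finset.sum_neg_distrib]
  exact Finset.sum_congr rfl fun k _ => by ring

lemma omg_add_right (n : ℕ) (a b c : Fin (2*n+1) → ℝ) :
    omg n a (b + c) = omg n a b + omg n a c := by
  rw [omg_swap, omg_add_left, omg_swap n a b, omg_swap n a c]; ring

lemma omg_smul_right (n : ℕ) (r : ℝ) (a b : Fin (2*n+1) → ℝ) :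
    omg n a (r • b) = r * omg n a b := by
  rw [omg_swap, omg_smul_left, omg_swap n a b]; ring

lemma omg_e1_left (n : ℕ) (a : Fin (2*n+1) → ℝ) : omg n (e1 n) a = 0 := by
  simp [omg, e1]

lemma omg_e1_right (n : ℕ) (a : Fin (2*n+1) → ℝ) : omg n a (e1 n) = 0 := by
  rw [omg_swap, omg_e1_left, neg_zero]

/-- The hyperplane `e₁^⊥` contains a symplectic pair as soon as `1 ≤ n`. -/
lemma exists_omg_eq_one {n : ℕ} (hn : 1 ≤ n) :
    ∃ u v : Fin (2*n+1) → ℝ, dot u (e1 n) = 0 ∧ dot v (e1 n) = 0 ∧ omg n u v = 1 := by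
  refine ⟨Pi.single ⟨1, by omega⟩ 1, Pi.single ⟨2, by omega⟩ 1, ?_, ?_, ?_⟩
  · simp [dot_e1, Fin.ext_iff]
  · simp [dot_e1, Fin.ext_iff]
  · rw [omg, Finset.sum_eq_single ⟨0, hn⟩]
    · simp [Fin.ext_iff]
    · intro k _ hk
      have : k.val ≠ 0 := fun h => hk (Fin.ext h)
      simp [Fin.ext_iff, this]
    · simp

section

variable {n : ℕ}
  {star : (Fin (2*n+1) → ℝ) →ₗ[ℝ] (Fin (2*n+1) → ℝ) →ₗ[ℝ] (Fin (2*n+1) → ℝ)}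

lemma star_self_of_dot_e1_eq_zero
    (hsq : ∀ u : Fin (2*n+1) → ℝ, dot u (e1 n) = 0 → dot u u = 1 → star u u = -(e1 n))
    {u : Fin (2*n+1) → ℝ} (hu : dot u (e1 n) = 0) :
    star u u = -(dot u u • e1 n) := by
  by_cases h0 : dot u u = 0
  · rw [h0, eq_zero_of_dot_self_eq_zero h0]; simp
  · have hs : √(dot u u) ≠ 0 := by
      rwa [Ne, Real.sqrt_eq_zero (dot_self_nonneg u)]
    have hss : √(dot u u) * √(dot u u) = dot u u := Real.mul_self_sqrt (dot_self_nonneg u)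
    set s := √(dot u u)
    have h := hsq (s⁻¹ • u) (by rw [dot_smul_left, hu, mul_zero])
      (by rw [dot_smul_left, dot_smul_right, ← hss]; field_simp)
    have key : star (s • s⁻¹ • u) (s • s⁻¹ • u) = -((s * s) • e1 n) := by
      rw [map_smul star s, LinearMap.smul_apply, map_smul _ s, h]; module
    rwa [smul_inv_smul₀ hs, hss] at key

lemma star_commutator_of_omg_ne_zero
    (hcomm : ∀ u v : Fin (2*n+1) → ℝ, dot u (e1 n) = 0 → dot v (e1 n) = 0 →
      omg n u v = 1 → star u v - star v u = (2:ℝ) • e1 n)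
    {u v : Fin (2*n+1) → ℝ} (hu : dot u (e1 n) = 0) (hv : dot v (e1 n) = 0)
    (h : omg n u v ≠ 0) :
    star u v - star v u = (2 * omg n u v) • e1 n := by
  have h1 := hcomm ((omg n u v)⁻¹ • u) v (by rw [dot_smul_left, hu, mul_zero]) hv
    (by rw [omg_smul_left, inv_mul_cancel₀ h])
  rw [map_smul, LinearMap.smul_apply, map_smul, ← smul_sub, inv_smul_eq_iff₀ h] at h1
  rw [h1]; module

lemma star_commutator_of_dot_e1_eq_zero (hn : 1 ≤ n)
    (hcomm : ∀ u v : Fin (2*n+1) → ℝ, dot u (e1 n) = 0 → dot v (e1 n) = 0 →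
      omg n u v = 1 → star u v - star v u = (2:ℝ) • e1 n)
    {u v : Fin (2*n+1) → ℝ} (hu : dot u (e1 n) = 0) (hv : dot v (e1 n) = 0) :
    star u v - star v u = (2 * omg n u v) • e1 n := by
  by_cases h : omg n u v = 0
  swap
  · exact star_commutator_of_omg_ne_zero hcomm hu hv h
  obtain ⟨x, y, hx, hy, hxy⟩ := exists_omg_eq_one hn
  have hbase := hcomm x y hx hy hxy
  set p := omg n u y + omg n x v with hp
  have along : ∀ t : ℝ, 0 < t → |p| < t →
      (star u v - star v u) + t • (star u y - star y u + (star x v - star v x)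
        - (2 * p) • e1 n) = 0 := by
    intro t ht hpt
    have hval : omg n (u + t • x) (v + t • y) = t * (p + t) := by
      simp only [omg_add_left, omg_add_right, omg_smul_left, omg_smul_right, h, hxy, hp]; ring
    have hne : t * (p + t) ≠ 0 := by
      have := neg_abs_le p
      exact (mul_pos ht (by linarith)).ne'
    have key := star_commutator_of_omg_ne_zero hcomm (u := u + t • x) (v := v + t • y)
      (by rw [dot_add_left, dot_smul_left, hu, hx]; ring)
      (by rw [dot_add_left, dot_smul_left, hv, hy]; ring) (by rwa [hval])
    rw [hval] at key
    simp only [map_add, map_smul, LinearMap.add_apply, LinearMap.smul_apply] at key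
    linear_combination (norm := module) key - (t * t) • hbase
  have hp0 := abs_nonneg p
  have h1 := along (|p| + 1) (by linarith) (by linarith)
  have h2 := along (2 * (|p| + 1)) (by linarith) (by linarith)
  rw [h]
  linear_combination (norm := module) (2 : ℝ) • h1 - h2

lemma star_of_dot_e1_eq_zero (hn : 1 ≤ n)
    (hsq : ∀ u : Fin (2*n+1) → ℝ, dot u (e1 n) = 0 → dot u u = 1 → star u u = -(e1 n))
    (hcomm : ∀ u v : Fin (2*n+1) → ℝ, dot u (e1 n) = 0 → dot v (e1 n) = 0 →
      omg n u v = 1 → star u v - star v u = (2:ℝ) • e1 n)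
    {u v : Fin (2*n+1) → ℝ} (hu : dot u (e1 n) = 0) (hv : dot v (e1 n) = 0) :
    star u v = (omg n u v - dot u v) • e1 n := by
  have hc := star_commutator_of_dot_e1_eq_zero hn hcomm hu hv
  have huu := star_self_of_dot_e1_eq_zero hsq hu
  have hvv := star_self_of_dot_e1_eq_zero hsq hv
  have hs := star_self_of_dot_e1_eq_zero hsq (u := u + v) (by rw [dot_add_left, hu, hv, add_zero])
  simp only [map_add, LinearMap.add_apply, dot_add_left, dot_add_right, dot_comm v u] at hs
  linear_combination (norm := module) (1 / 2 : ℝ) • (hc + hs - huu - hvv)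

end

/-- A bilinear product on `ℝ^{2n+1}` with two-sided unit `e₁`
satisfying `u ⋆ u = −e₁` for unit `u ∈ e₁^⊥` and `u⋆v − v⋆u = 2e₁` whenever
`u, v ∈ e₁^⊥` with `ω(u,v) = 1`, coincides with the Vidinli multiplication;
in particular its commutator is `2ω(a,b)e₁` (the Heisenberg structure). -/
theorem vidinli_local_characterization (n : ℕ) (hn : 1 ≤ n)
    (star : (Fin (2*n+1) → ℝ) →ₗ[ℝ] (Fin (2*n+1) → ℝ) →ₗ[ℝ] (Fin (2*n+1) → ℝ))
    (hunitL : ∀ a : Fin (2*n+1) → ℝ, star (e1 n) a = a)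
    (hunitR : ∀ a : Fin (2*n+1) → ℝ, star a (e1 n) = a)
    (hsq : ∀ u : Fin (2*n+1) → ℝ, dot u (e1 n) = 0 → dot u u = 1 →
      star u u = -(e1 n))
    (hcomm : ∀ u v : Fin (2*n+1) → ℝ, dot u (e1 n) = 0 → dot v (e1 n) = 0 →
      omg n u v = 1 → star u v - star v u = (2:ℝ) • e1 n) :
    (∀ a b : Fin (2*n+1) → ℝ, star a b = vprod n a b) ∧
    (∀ a b : Fin (2*n+1) → ℝ,
      star a b - star b a = (2 * omg n a b) • e1 n) := by
  have hprod : ∀ a b : Fin (2*n+1) → ℝ, star a b = vprod n a b := by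
    intro a b
    have hdecomp : ∀ c : Fin (2*n+1) → ℝ, ∃ (r : ℝ) (u : Fin (2*n+1) → ℝ),
        dot u (e1 n) = 0 ∧ c = r • e1 n + u := fun c =>
      ⟨dot c (e1 n), c + (-dot c (e1 n)) • e1 n,
        by rw [dot_add_left, dot_smul_left, dot_e1_e1]; ring, by module⟩
    obtain ⟨r, u, hu, rfl⟩ := hdecomp a
    obtain ⟨s, v, hv, rfl⟩ := hdecomp b
    have huv := star_of_dot_e1_eq_zero hn hsq hcomm hu hv
    simp only [vprod, map_add, map_smul, LinearMap.add_apply, LinearMap.smul_apply, hunitL,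
      hunitR, huv, dot_add_left, dot_add_right, dot_smul_left, dot_smul_right, dot_e1_e1, hu, hv,
      dot_comm (e1 n) v, omg_add_left, omg_add_right, omg_smul_left, omg_smul_right,
      omg_e1_left, omg_e1_right]
    module
  refine ⟨hprod, fun a b => ?_⟩
  rw [hprod, hprod, vprod, vprod, dot_comm b a, omg_swap n a b]
  module
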